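/- Let H be a finite-dimensional complex Hilbert space with dim H ≥ 2. Every injective map φ: P(H) → P(H) satisfying ‖φ(P) − φ(Q)‖ ≤ ‖P − Q‖ for all P, Q ∈ P(H) is a Wigner symmetry. -/

import Mathlib

open scoped InnerProductSpace ComplexConjugate

variable {H : Type*} [NormedAddCommGroup H] [InnerProductSpace ℂ H] [CompleteSpace H]

/-- The rank-one (orthogonal) projection onto the span of a unit vector `v`,
i.e. `x ↦ ⟪v, x⟫ • v`. -/
noncomputable def rankOneProj (v : H) : H →L[ℂ] H :=
  (innerSL ℂ v).smulRight v

/-- A rank-one projection: a self-adjoint idempotent bounded operator with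
one-dimensional range. -/
def IsRankOneProjection (P : H →L[ℂ] H) : Prop :=
  IsSelfAdjoint P ∧ P ∘L P = P ∧ Module.finrank ℂ (LinearMap.range (P : H →ₗ[ℂ] H)) = 1

/-- `φ` is a Wigner symmetry: there is a unitary or antiunitary operator `U` on `H`
(an additive, norm-preserving, surjective map that is `ℂ`-linear or conjugate-linear)
such that `φ P = U P U*` for every rank-one projection `P`; equivalently, `φ` sends the
projection onto `ℂv` to the projection onto `ℂ(Uv)` for every unit vector `v`. -/
def IsWignerSymmetry
    (φ : {P : H →L[ℂ] H // IsRankOneProjection P} → {P : H →L[ℂ] H // IsRankOneProjection P}) :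
    Prop :=
  ∃ U : H → H,
    (∀ x y, U (x + y) = U x + U y) ∧
    (∀ x, ‖U x‖ = ‖x‖) ∧
    Function.Surjective U ∧
    ((∀ (c : ℂ) (x : H), U (c • x) = c • U x) ∨
      (∀ (c : ℂ) (x : H), U (c • x) = (starRingEnd ℂ) c • U x)) ∧
    (∀ (v : H), ‖v‖ = 1 → ∀ P : {P : H →L[ℂ] H // IsRankOneProjection P},
      P.1 = rankOneProj v → (φ P).1 = rankOneProj (U v))

section FixedPoint

open MeasureTheory Metric Set

variable {E : Type*} [NormedAddCommGroup E] [InnerProductSpace ℝ E] [FiniteDimensional ℝ E]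

theorem exists_polynomial_eval_eq_det_one_add_smul (A : E →L[ℝ] E) :
    ∃ p : Polynomial ℝ, p.natDegree ≤ Module.finrank ℝ E ∧
      ∀ t : ℝ, (1 + t • A).det = p.eval t := by
  classical
  let b := Module.finBasis ℝ E
  let M := LinearMap.toMatrix b b (A : E →ₗ[ℝ] E)
  let N : Matrix (Fin (Module.finrank ℝ E)) (Fin (Module.finrank ℝ E)) (Polynomial ℝ) :=
    (Polynomial.X : Polynomial ℝ) • M.map (Polynomial.C : ℝ →+* Polynomial ℝ) +
      (1 : Matrix (Fin (Module.finrank ℝ E)) (Fin (Module.finrank ℝ E)) ℝ).map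
        (Polynomial.C : ℝ →+* Polynomial ℝ)
  refine ⟨N.det, by simpa [N] using Polynomial.natDegree_det_X_add_C_le M 1, fun t => ?_⟩
  rw [← Polynomial.coe_evalRingHom, RingHom.map_det]
  have h1 : ((1 + t • A : E →L[ℝ] E) : E →ₗ[ℝ] E) =
    LinearMap.id + t • (A : E →ₗ[ℝ] E) := rfl
  have : (LinearMap.toMatrix b b ((1 + t • A : E →L[ℝ] E) : E →ₗ[ℝ] E)) =
      (Polynomial.evalRingHom t).mapMatrix N := by
    rw [h1, map_add, LinearMap.toMatrix_id, map_smul]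
    ext i j
    by_cases hij : i = j <;> simp [hij, M, N, add_comm, mul_comm t]
  rw [← this, LinearMap.det_toMatrix]

theorem det_one_add_ne_zero {A : E →L[ℝ] E} (hA : ‖A‖ < 1) : (1 + A).det ≠ 0 := by
  intro h
  obtain ⟨v, hv, hv0⟩ := Submodule.exists_mem_ne_zero_of_ne_bot
    (LinearMap.det_eq_zero_iff_ker_ne_bot.1 h)
  have h1 : v + A v = 0 := hv
  have h2 : ‖v‖ ≤ ‖A‖ * ‖v‖ := by
    rw [eq_neg_of_add_eq_zero_left h1, norm_neg]
    simpa [← eq_neg_of_add_eq_zero_left h1] using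
      (A.le_opNorm v).trans_eq (by rw [eq_neg_of_add_eq_zero_right h1, norm_neg])
  nlinarith [norm_pos_iff.2 hv0]

theorem det_one_add_pos {A : E →L[ℝ] E} (hA : ‖A‖ < 1) : 0 < (1 + A).det := by
  obtain ⟨p, -, hp⟩ := exists_polynomial_eval_eq_det_one_add_smul A
  by_contra! hneg
  have h0 : p.eval 0 = 1 := by
    rw [← hp, zero_smul, add_zero]
    exact LinearMap.det_id
  have h1 : p.eval 1 ≤ 0 := by rwa [← hp, one_smul]
  obtain ⟨t, ht, ht0⟩ := intermediate_value_Icc' zero_le_one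
    (p.continuous.continuousOn (s := Icc (0 : ℝ) 1))
    (show (0 : ℝ) ∈ Icc (p.eval 1) (p.eval 0) from ⟨h1, by rw [h0]; exact zero_le_one⟩)
  refine det_one_add_ne_zero (A := t • A) ?_ ((hp t).trans ht0)
  rw [norm_smul, Real.norm_eq_abs, abs_of_nonneg ht.1]
  nlinarith [ht.2, norm_nonneg A]

theorem bijective_add_smul {u : E → E} {L : NNReal} (hu : LipschitzWith L u) {t : ℝ}
    (ht : 0 ≤ t) (htL : t * L < 1) : Function.Bijective fun x => x + t • u x := by
  constructor
  · intro x y hxy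
    have h1 : x - y = t • (u y - u x) := by
      rw [smul_sub, sub_eq_sub_iff_add_eq_add, add_comm (t • u y) y]
      exact hxy
    have h2 : ‖x - y‖ ≤ t * (L * ‖x - y‖) := by
      conv_lhs => rw [h1, norm_smul, Real.norm_eq_abs, abs_of_nonneg ht]
      have := hu.norm_sub_le y x
      rw [norm_sub_rev y x] at this
      gcongr
    by_contra hne
    have := norm_pos_iff.2 (sub_ne_zero.2 hne)
    nlinarith
  · intro y
    have hc : ContractingWith (t.toNNReal * L) fun x => y - t • u x := by
      refine ⟨NNReal.coe_lt_coe.1 (by simpa [ht] using htL), LipschitzWith.of_dist_le_mul fun a b => ?_⟩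
      rw [dist_sub_left, dist_smul₀, Real.norm_eq_abs, abs_of_nonneg ht]
      have := hu.dist_le_mul a b
      calc t * dist (u a) (u b) ≤ t * (L * dist a b) := by gcongr
        _ = _ := by simp [ht, mul_assoc]
    refine ⟨hc.fixedPoint, ?_⟩
    have := hc.fixedPoint_isFixedPt
    exact eq_sub_iff_add_eq.1 this.symm

theorem image_ball_add_smul {u : E → E} {L : NNReal} (hu : LipschitzWith L u) {R : ℝ}
    (hout : ∀ x, R ≤ ‖x‖ → u x = 0) {t : ℝ} (ht : 0 ≤ t) (htL : t * L < 1) :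
    (fun x => x + t • u x) '' ball 0 R = ball 0 R := by
  have hbij := bijective_add_smul hu ht htL
  have hfix : ∀ x, x ∉ ball (0 : E) R → x + t • u x = x := fun x hx => by
    rw [hout x (by simpa using hx), smul_zero, add_zero]
  apply subset_antisymm
  · rintro _ ⟨x, hx, rfl⟩
    by_contra hy
    have h1 := hbij.1 (hfix _ hy)
    exact hy (by simpa only [h1] using hx)
  · intro y hy
    obtain ⟨x, rfl⟩ := hbij.2 y
    refine ⟨x, ?_, rfl⟩
    by_contra hx
    simp only [hfix x hx] at hy
    exact hx hy

theorem det_eq_zero_of_norm_eq {r : E → E} {r' : E →L[ℝ] E} {x : E} {R : ℝ} (hR : 0 < R)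
    (hr : HasFDerivAt r r' x) (hnorm : ∀ᶠ y in nhds x, ‖r y‖ = R) : r'.det = 0 := by
  by_contra hdet
  have hsurj : Function.Surjective r' := by
    have hker : LinearMap.ker (r' : E →ₗ[ℝ] E) = ⊥ := by
      by_contra h
      exact hdet (LinearMap.det_eq_zero_iff_ker_ne_bot.2 h)
    exact LinearMap.injective_iff_surjective.1 (LinearMap.ker_eq_bot.1 hker)
  obtain ⟨v, hv⟩ := hsurj (r x)
  have h1 := (hr.norm_sq).congr_of_eventuallyEq
    (f₁ := fun _ => R ^ 2) (hnorm.mono fun y hy => by simp [hy])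
  have h2 := h1.unique (hasFDerivAt_const (R ^ 2) x)
  have h3 := DFunLike.congr_fun h2 v
  simp [hv, hnorm.self_of_nhds] at h3
  exact hR.ne' h3

theorem no_lipschitz_retraction_onto_sphere {u : E → E} {L : NNReal} (hu : LipschitzWith L u)
    {R : ℝ} (hR : 0 < R) (hdiff : DifferentiableOn ℝ u (ball 0 R))
    (hout : ∀ x, R ≤ ‖x‖ → u x = 0) (hin : ∀ x ∈ ball (0 : E) R, ‖x + u x‖ = R) : False := by
  borelize E
  let μ : Measure E := volume
  have hderiv : ∀ t : ℝ, ∀ x ∈ ball (0 : E) R,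
      HasFDerivAt (fun x => x + t • u x) (1 + t • fderiv ℝ u x) x := fun t x hx =>
    (hasFDerivAt_id x).add
      (((hdiff x hx).differentiableAt (isOpen_ball.mem_nhds hx)).hasFDerivAt.const_smul t)
  have hsmall : ∀ t : ℝ, 0 ≤ t → t * L < 1 →
      IntegrableOn (fun x => (1 + t • fderiv ℝ u x).det) (ball 0 R) μ ∧
      ∫ x in ball 0 R, (1 + t • fderiv ℝ u x).det ∂μ = μ.real (ball 0 R) := by
    intro t ht htL
    have hpos : ∀ x, |(1 + t • fderiv ℝ u x).det| • (1 : ℝ) = (1 + t • fderiv ℝ u x).det := by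
      intro x
      rw [smul_eq_mul, mul_one, abs_of_pos]
      apply det_one_add_pos
      rw [norm_smul, Real.norm_eq_abs, abs_of_nonneg ht]
      exact lt_of_le_of_lt (by gcongr; exact norm_fderiv_le_of_lipschitz ℝ hu) htL
    have hd : ∀ x ∈ ball (0 : E) R, HasFDerivWithinAt (fun x => x + t • u x)
        (1 + t • fderiv ℝ u x) (ball 0 R) x := fun x hx => (hderiv t x hx).hasFDerivWithinAt
    have hinj := (bijective_add_smul hu ht htL).1.injOn (s := ball 0 R)
    have hi := integrableOn_image_iff_integrableOn_abs_det_fderiv_smul μ measurableSet_ball hd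
      hinj (fun _ => (1 : ℝ))
    have he := integral_image_eq_integral_abs_det_fderiv_smul μ measurableSet_ball hd
      hinj (fun _ => (1 : ℝ))
    rw [image_ball_add_smul hu hout ht htL] at hi he
    simp only [hpos] at hi he
    refine ⟨hi.1 (integrableOn_const measure_ball_lt_top.ne), ?_⟩
    rw [← he]
    simp
  let n := Module.finrank ℝ E
  let s := Finset.range (n + 1)
  let v : ℕ → ℝ := fun k => ((k + 1) * (L + 1))⁻¹
  have hv : ∀ k, 0 ≤ v k ∧ v k * L < 1 := by
    intro k
    refine ⟨by positivity, ?_⟩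
    rw [inv_mul_lt_one₀ (by positivity)]
    have : (0 : ℝ) ≤ k := k.cast_nonneg
    nlinarith [L.2]
  have hvinj : Set.InjOn v s := by
    intro a _ b _ hab
    have hL : (L : ℝ) + 1 ≠ 0 := by positivity
    simpa [v, hL] using hab
  let c : ℕ → ℝ := fun k => (Lagrange.basis s v k).eval 1
  have hc : ∑ k ∈ s, c k = 1 := by
    have := congrArg (Polynomial.eval 1) (Lagrange.sum_basis hvinj (by simp [s]))
    simpa [Polynomial.eval_finsetSum] using this
  have hinterp : ∀ x, (1 + (1 : ℝ) • fderiv ℝ u x).det =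
      ∑ k ∈ s, c k * (1 + v k • fderiv ℝ u x).det := by
    intro x
    obtain ⟨p, hpdeg, hp⟩ := exists_polynomial_eval_eq_det_one_add_smul (fderiv ℝ u x)
    have hlt : p.degree < s.card := by
      refine lt_of_le_of_lt Polynomial.degree_le_natDegree ?_
      rw [Finset.card_range]
      exact_mod_cast Nat.lt_succ_of_le hpdeg
    have := congrArg (Polynomial.eval 1) (Lagrange.eq_interpolate hvinj hlt)
    rw [Lagrange.interpolate_apply, Polynomial.eval_finsetSum] at this
    simp only [hp]
    rw [this]
    simp [c, mul_comm]
  have hzero : ∫ x in ball 0 R, (1 + (1 : ℝ) • fderiv ℝ u x).det ∂μ = 0 := by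
    rw [setIntegral_congr_fun (g := fun _ => (0 : ℝ)) measurableSet_ball, integral_zero]
    intro x hx
    refine det_eq_zero_of_norm_eq hR (hderiv 1 x hx) ?_
    filter_upwards [isOpen_ball.mem_nhds hx] with y hy
    rw [one_smul, hin y hy]
  simp only [hinterp] at hzero
  rw [integral_finsetSum _ fun k _ => ((hsmall _ (hv k).1 (hv k).2).1.const_mul _)] at hzero
  simp only [integral_const_mul, (hsmall _ (hv _).1 (hv _).2).2, ← Finset.sum_mul, hc,
    one_mul] at hzero
  exact (ENNReal.toReal_pos (measure_ball_pos μ 0 hR).ne' measure_ball_lt_top.ne).ne' hzero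

omit [FiniteDimensional ℝ E] in
theorem lipschitzWith_indicator_ball {g : E → E} {K : NNReal} {R : ℝ} (hR : 0 < R)
    (hg : LipschitzOnWith K g (closedBall 0 R)) (hg0 : ∀ x, ‖x‖ = R → g x = 0) :
    LipschitzWith K ((ball 0 R).indicator g) := by
  have key : ∀ x y : E, x ∈ ball 0 R → y ∉ ball 0 R → ‖g x‖ ≤ K * ‖x - y‖ := by
    intro x y hx hy
    rw [mem_ball_zero_iff] at hx hy
    have hyR : R ≤ ‖y‖ := not_lt.1 hy
    obtain ⟨z, hz, hxz⟩ : ∃ z : E, ‖z‖ = R ∧ ‖x - z‖ ≤ ‖x - y‖ := by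
      rcases eq_or_ne x 0 with rfl | hx0
      · refine ⟨(R / ‖y‖) • y, ?_, ?_⟩
        · rw [norm_smul, norm_div, norm_norm, Real.norm_of_nonneg hR.le]
          exact div_mul_cancel₀ _ (hR.trans_le hyR).ne'
        · rw [zero_sub, zero_sub, norm_neg, norm_neg, norm_smul, norm_div, norm_norm,
            Real.norm_of_nonneg hR.le, div_mul_cancel₀ _ (hR.trans_le hyR).ne']
          exact hyR
      · have hx0' := norm_pos_iff.2 hx0
        refine ⟨(R / ‖x‖) • x, ?_, ?_⟩
        · rw [norm_smul, norm_div, norm_norm, Real.norm_of_nonneg hR.le]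
          exact div_mul_cancel₀ _ hx0'.ne'
        · have : x - (R / ‖x‖) • x = ((‖x‖ - R) / ‖x‖) • x := by
            rw [sub_div, div_self hx0'.ne', sub_smul, one_smul]
          rw [this, norm_smul, norm_div, norm_norm, div_mul_cancel₀ _ hx0'.ne',
            Real.norm_of_nonpos (by linarith)]
          have := norm_sub_norm_le y x
          rw [norm_sub_rev] at this
          linarith
    have h := hg.norm_sub_le (x := x) (y := z) (by simpa using hx.le) (by simp [hz])
    rw [hg0 z hz, sub_zero] at h
    exact h.trans (by gcongr)
  refine LipschitzWith.of_dist_le_mul fun x y => ?_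
  rw [dist_eq_norm, dist_eq_norm]
  by_cases hx : x ∈ ball (0 : E) R <;> by_cases hy : y ∈ ball (0 : E) R
  · rw [indicator_of_mem hx, indicator_of_mem hy]
    exact hg.norm_sub_le (ball_subset_closedBall hx) (ball_subset_closedBall hy)
  · rw [indicator_of_mem hx, indicator_of_notMem hy, sub_zero]
    exact key x y hx hy
  · rw [indicator_of_notMem hx, indicator_of_mem hy, zero_sub, norm_neg, norm_sub_rev]
    exact key y x hy hx
  · rw [indicator_of_notMem hx, indicator_of_notMem hy, sub_zero, norm_zero]
    positivity

theorem exists_fixedPoint_of_contDiff {w : E → E} (hw : ContDiff ℝ 1 w)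
    (hc : HasCompactSupport w) : ∃ x, w x = x := by
  by_contra! hne
  obtain ⟨R, hR, hsub⟩ := hc.isCompact.isBounded.subset_ball_lt 0 0
  have hw0 : ∀ x, R ≤ ‖x‖ → w x = 0 := fun x hx => by
    by_contra h
    have := hsub (subset_tsupport w h)
    rw [mem_ball_zero_iff] at this
    linarith
  have hh0 : ∀ x, x - w x ≠ 0 := fun x h => hne x (sub_eq_zero.1 h).symm
  let g : E → E := fun x => R • (‖x - w x‖⁻¹ • (x - w x)) - x
  have hh : ContDiff ℝ 1 fun x => x - w x := contDiff_id.sub hw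
  have hg : ContDiff ℝ 1 g :=
    ((((hh.norm ℝ hh0).inv fun x => norm_ne_zero_iff.2 (hh0 x)).smul hh).const_smul R).sub
      contDiff_id
  have hg0 : ∀ x, ‖x‖ = R → g x = 0 := fun x hx => by
    simp only [g, hw0 x hx.ge, sub_zero, hx, smul_smul]
    rw [mul_inv_cancel₀ hR.ne', one_smul, sub_self]
  obtain ⟨K, hK⟩ := hg.contDiffOn.exists_lipschitzOnWith one_ne_zero
    (convex_closedBall (0 : E) R) (isCompact_closedBall 0 R)
  refine no_lipschitz_retraction_onto_sphere (lipschitzWith_indicator_ball hR hK hg0) hR ?_ ?_ ?_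
  · exact (hg.differentiable one_ne_zero).differentiableOn.congr fun x hx => indicator_of_mem hx g
  · exact fun x hx => indicator_of_notMem (by simpa using hx) g
  · intro x hx
    rw [indicator_of_mem hx]
    simp only [g]
    rw [add_sub_cancel, norm_smul, norm_smul, norm_inv, norm_norm,
      inv_mul_cancel₀ (norm_ne_zero_iff.2 (hh0 x)), mul_one, Real.norm_of_nonneg hR.le]

theorem exists_fixedPoint_of_hasCompactSupport {w : E → E} (hw : Continuous w)
    (hc : HasCompactSupport w) : ∃ x, w x = x := by
  by_contra! hne
  obtain ⟨R, hR, hsub⟩ := hc.isCompact.isBounded.subset_ball_lt 0 0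
  have hw0 : ∀ x, x ∉ ball (0 : E) R → w x = 0 := fun x hx => by
    by_contra h
    exact hx (hsub (subset_tsupport w h))
  obtain ⟨y, -, hy⟩ := (isCompact_closedBall (0 : E) R).exists_isMinOn ⟨0, by simpa using hR.le⟩
    (f := fun x => ‖x - w x‖) (by fun_prop)
  have hpos : 0 < ‖y - w y‖ := norm_pos_iff.2 fun h => hne y (sub_eq_zero.1 h).symm
  obtain ⟨g, hg, hgw, hsupp⟩ := hw.exists_contDiff_approx (ε := fun _ => ‖y - w y‖) 1
    continuous_const fun _ => hpos
  obtain ⟨x, hx⟩ := exists_fixedPoint_of_contDiff (w := g) (by exact_mod_cast hg) (hc.mono hsupp)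
  have hxR : x ∈ closedBall (0 : E) R := by
    by_contra hxR
    have h0 : g x = 0 := by
      by_contra h
      exact hsupp h (hw0 x fun h => hxR (ball_subset_closedBall h))
    rw [← hx, h0] at hxR
    exact hxR (by simpa using hR.le)
  have h1 := hgw x
  rw [hx, dist_eq_norm] at h1
  exact absurd (isMinOn_iff.1 hy x hxR) (not_le.2 h1)

/-- **Brouwer's fixed point theorem** for the closed unit ball. -/
theorem exists_fixedPoint_closedBall {w : E → E} (hw : ContinuousOn w (closedBall 0 1))
    (hmaps : MapsTo w (closedBall 0 1) (closedBall 0 1)) : ∃ x ∈ closedBall (0 : E) 1, w x = x := by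
  let p : E → E := fun x => (max 1 ‖x‖)⁻¹ • x
  have hp : Continuous p :=
    (Continuous.inv₀ (by fun_prop) fun x => (lt_max_of_lt_left one_pos).ne').smul continuous_id
  have hpm : ∀ x, p x ∈ closedBall (0 : E) 1 := fun x => by
    rw [mem_closedBall_zero_iff, norm_smul, norm_inv,
      Real.norm_of_nonneg (le_max_of_le_left zero_le_one),
      inv_mul_le_one₀ (lt_max_of_lt_left one_pos)]
    exact le_max_right _ _
  let l : E → ℝ := fun x => max 0 (min 1 (2 - ‖x‖))
  have hl0 : ∀ x, 0 ≤ l x := fun x => le_max_left _ _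
  have hl1 : ∀ x, l x ≤ 1 := fun x => max_le zero_le_one (min_le_left _ _)
  have hcont : Continuous fun x => l x • w (p x) :=
    Continuous.smul (by fun_prop) (hw.comp_continuous hp hpm)
  have hsupp : HasCompactSupport fun x => l x • w (p x) := by
    refine HasCompactSupport.intro (isCompact_closedBall (0 : E) 2) fun x hx => ?_
    rw [mem_closedBall_zero_iff, not_le] at hx
    have : l x = 0 := max_eq_left ((min_le_right _ _).trans (by linarith))
    simp only [this, zero_smul]
  obtain ⟨x, hx⟩ := exists_fixedPoint_of_hasCompactSupport hcont hsupp
  have hx1 : ‖x‖ ≤ 1 := by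
    rw [← hx, norm_smul, Real.norm_of_nonneg (hl0 x)]
    have := mem_closedBall_zero_iff.1 (hmaps (hpm x))
    nlinarith [hl0 x, hl1 x, norm_nonneg (w (p x))]
  have hpx : p x = x := by simp [p, max_eq_left hx1]
  have hlx : l x = 1 := by
    simp only [l]
    rw [min_eq_left (by linarith), max_eq_right zero_le_one]
  rw [hpx, hlx, one_smul] at hx
  exact ⟨x, mem_closedBall_zero_iff.2 hx1, hx⟩

/-- **Invariance of domain** on the closed unit ball. -/
theorem image_closedBall_mem_nhds_of_injOn {f : E → E} (hf : ContinuousOn f (closedBall 0 1))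
    (hinj : InjOn f (closedBall 0 1)) : f '' closedBall 0 1 ∈ nhds (f 0) := by
  borelize E
  by_contra hY
  have hK : IsCompact (closedBall (0 : E) 1) := isCompact_closedBall 0 1
  have hYc : IsCompact (f '' closedBall 0 1) := hK.image_of_continuousOn hf
  obtain ⟨G, hG, hGf⟩ : ∃ G : E → E, Continuous G ∧ ∀ x ∈ closedBall (0 : E) 1, G (f x) = x := by
    have : CompactSpace (closedBall (0 : E) 1) := isCompact_iff_compactSpace.1 hK
    have he : Topology.IsClosedEmbedding ((closedBall (0 : E) 1).domRestrict f) :=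
      hf.domRestrict.isClosedEmbedding hinj.injective
    obtain ⟨G, hG⟩ := ContinuousMap.exists_extension he
      (⟨Subtype.val, continuous_subtype_val⟩ : C(closedBall (0 : E) 1, E))
    exact ⟨G, G.continuous, fun x hx => DFunLike.congr_fun hG ⟨x, hx⟩⟩
  have hG0 : G (f 0) = 0 := hGf 0 (by simp)
  obtain ⟨ε, hε, hGε⟩ : ∃ ε > 0, ∀ y, dist y (f 0) < 2 * ε → ‖G y‖ ≤ 1 / 10 := by
    obtain ⟨ε, hε, h⟩ := Metric.continuousAt_iff.1 (hG.continuousAt (x := f 0)) (1 / 10) (by norm_num)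
    refine ⟨ε / 2, by positivity, fun y hy => ?_⟩
    have := h (show dist y (f 0) < ε by linarith)
    rw [hG0, dist_zero_right] at this
    exact this.le
  obtain ⟨c, hc, hcY⟩ : ∃ c, dist c (f 0) < ε ∧ c ∉ f '' closedBall 0 1 := by
    by_contra! h
    exact hY (Filter.mem_of_superset (ball_mem_nhds _ hε) fun c hc => h c hc)
  have hGc : ∀ y, dist y c ≤ ε → ‖G y‖ ≤ 1 / 10 := fun y hy =>
    hGε y (by linarith [dist_triangle y c (f 0)])
  have h_out : IsCompact (f '' closedBall 0 1 ∩ (ball c ε)ᶜ) := hYc.inter_right isOpen_ball.isClosed_compl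
  obtain ⟨δ, hδ, hδ1, hδle⟩ : ∃ δ > 0, δ ≤ 1 / 10 ∧
      ∀ y ∈ f '' closedBall 0 1, y ∉ ball c ε → δ ≤ ‖G y‖ := by
    have h0 : ∀ y ∈ f '' closedBall 0 1 ∩ (ball c ε)ᶜ, 0 < ‖G y‖ := by
      rintro _ ⟨⟨x, hx, rfl⟩, hy⟩
      rw [hGf x hx, norm_pos_iff]
      rintro rfl
      exact hy (mem_ball'.2 hc)
    obtain ⟨δ, hδ, h⟩ := h_out.exists_forall_le' hG.norm.continuousOn h0
    exact ⟨min δ (1 / 10), lt_min hδ (by norm_num), min_le_right _ _,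
      fun y hy hy' => (min_le_left _ _).trans (h y ⟨hy, hy'⟩)⟩
  obtain ⟨P, hP, hPG, -⟩ := hG.exists_contDiff_approx (ε := fun _ => δ / 2) 1 continuous_const
    fun _ => half_pos hδ
  have hnull : volume (P '' sphere c ε) = 0 :=
    addHaar_image_eq_zero_of_differentiableOn_of_addHaar_eq_zero volume
      (hP.differentiable (by simp)).differentiableOn (Measure.addHaar_sphere_of_ne_zero _ _ hε.ne')
  obtain ⟨b, hb, hbP⟩ : ∃ b ∈ ball (0 : E) (δ / 2), b ∉ P '' sphere c ε := by
    by_contra! h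
    exact (measure_ball_pos volume (0 : E) (half_pos hδ)).ne' (measure_mono_null h hnull)
  rw [mem_ball_zero_iff] at hb
  have hPb : ∀ y, ‖G y - (P y - b)‖ < δ := fun y => by
    have h1 := hPG y
    rw [dist_eq_norm, norm_sub_rev] at h1
    calc ‖G y - (P y - b)‖ = ‖(G y - P y) + b‖ := by congr 1; abel
      _ ≤ ‖G y - P y‖ + ‖b‖ := norm_add_le _ _
      _ < δ := by linarith
  let Φ : E → E := fun y => c + (max ε ‖y - c‖ / ‖y - c‖) • (y - c)
  have hfc : ∀ x ∈ closedBall (0 : E) 1, ‖f x - c‖ ≠ 0 := fun x hx h =>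
    hcY ⟨x, hx, sub_eq_zero.1 (norm_eq_zero.1 h)⟩
  have hΦf : ContinuousOn (fun x => Φ (f x)) (closedBall 0 1) := by
    refine continuousOn_const.add (ContinuousOn.smul (ContinuousOn.div ?_ ?_ hfc) ?_) <;> fun_prop
  have hΦout : ∀ x ∈ closedBall (0 : E) 1, f x ∉ ball c ε → Φ (f x) = f x := fun x hx h => by
    simp only [Φ]
    rw [mem_ball_iff_norm, not_lt] at h
    rw [max_eq_right h, div_self (hfc x hx), one_smul, add_sub_cancel]
  have hΦin : ∀ x ∈ closedBall (0 : E) 1, f x ∈ ball c ε → Φ (f x) ∈ sphere c ε := fun x hx h => by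
    simp only [Φ]
    rw [mem_ball_iff_norm] at h
    rw [max_eq_left h.le, mem_sphere_iff_norm, add_sub_cancel_left, norm_smul, norm_div, norm_norm,
      div_mul_cancel₀ _ (hfc x hx), Real.norm_of_nonneg hε.le]
  obtain ⟨x, hx, hfix⟩ := exists_fixedPoint_closedBall (w := fun x => x - (P (Φ (f x)) - b))
    (continuousOn_id.sub ((hP.continuous.comp_continuousOn hΦf).sub continuousOn_const)) (by
      intro x hx
      rw [mem_closedBall_zero_iff]
      by_cases h : f x ∈ ball c ε
      · have h1 := hPb (Φ (f x))
        have h2 := hGc _ (mem_closedBall.1 (sphere_subset_closedBall (hΦin x hx h)))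
        have h3 := hGc _ (mem_ball.1 h).le
        rw [hGf x hx] at h3
        calc ‖x - (P (Φ (f x)) - b)‖ = ‖x - G (Φ (f x)) + (G (Φ (f x)) - (P (Φ (f x)) - b))‖ := by
              congr 1; abel
          _ ≤ ‖x‖ + ‖G (Φ (f x))‖ + ‖G (Φ (f x)) - (P (Φ (f x)) - b)‖ :=
              (norm_add_le _ _).trans (by gcongr; exact norm_sub_le _ _)
          _ ≤ 1 := by linarith
      · have h1 := hPb (f x)
        rw [hGf x hx] at h1
        simp only [hΦout x hx h]
        linarith)
  have hzero : P (Φ (f x)) - b = 0 := by simpa using hfix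
  by_cases h : f x ∈ ball c ε
  · exact hbP ⟨_, hΦin x hx h, sub_eq_zero.1 hzero⟩
  · rw [hΦout x hx h] at hzero
    have h1 := hPb (f x)
    rw [hzero, sub_zero] at h1
    exact absurd (hδle _ (mem_image_of_mem f hx) h) (not_le.2 h1)

end FixedPoint

section InvarianceOfDomain

open Metric Set

/-- **Invariance of domain** between real vector spaces of the same finite dimension. -/
theorem image_mem_nhds_of_injOn {V W : Type*} [NormedAddCommGroup V] [NormedSpace ℝ V]
    [FiniteDimensional ℝ V] [NormedAddCommGroup W] [NormedSpace ℝ W] [FiniteDimensional ℝ W]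
    (hdim : Module.finrank ℝ V = Module.finrank ℝ W) {f : V → W} {s : Set V} {a : V}
    (hs : s ∈ nhds a) (hf : ContinuousOn f s) (hinj : InjOn f s) : f '' s ∈ nhds (f a) := by
  let E := EuclideanSpace ℝ (Fin (Module.finrank ℝ V))
  let eV : E ≃L[ℝ] V := ContinuousLinearEquiv.ofFinrankEq (by simp [E])
  let eW : E ≃L[ℝ] W := ContinuousLinearEquiv.ofFinrankEq (by simp [E, hdim])
  let c : E → V := fun x => a + eV x
  have hcc : Continuous c := by fun_prop
  have hc0 : c 0 = a := by simp [c]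
  have hcinj : Function.Injective c := fun x y h => eV.injective (add_left_cancel h)
  obtain ⟨r, hr, hrs⟩ := Metric.nhds_basis_closedBall.mem_iff.1
    (hcc.continuousAt.preimage_mem_nhds (by rwa [hc0]) : c ⁻¹' s ∈ nhds (0 : E))
  have hm : MapsTo (fun x : E => c (r • x)) (closedBall 0 1) s := fun x hx => hrs (by
    rw [mem_closedBall_zero_iff] at hx ⊢
    rw [norm_smul, Real.norm_of_nonneg hr.le]
    nlinarith)
  have key := image_closedBall_mem_nhds_of_injOn (f := fun x => eW.symm (f (c (r • x))))
    (eW.symm.continuous.comp_continuousOn (hf.comp (by fun_prop) hm)) (by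
      intro x hx y hy hxy
      have h1 := hcinj (hinj (hm hx) (hm hy) (eW.symm.injective hxy))
      exact smul_right_injective E hr.ne' h1)
  simp only [smul_zero, hc0] at key
  have key2 := eW.toHomeomorph.isOpenMap.image_mem_nhds key
  simp only [ContinuousLinearEquiv.coe_toHomeomorph, ContinuousLinearEquiv.apply_symm_apply,
    image_image] at key2
  refine Filter.mem_of_superset key2 ?_
  rintro _ ⟨x, hx, rfl⟩
  exact mem_image_of_mem f (hm hx)

end InvarianceOfDomain

section Wigner

variable {K : Type*} [NormedAddCommGroup K] [InnerProductSpace ℂ K] {ι : Type*}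

theorem Complex.eq_of_norm_add_eq_two {z w : ℂ} (hz : ‖z‖ = 1) (hw : ‖w‖ = 1)
    (h : ‖z + w‖ = 2) : z = w := by
  have h1 := parallelogram_law_with_norm ℝ z w
  rw [h, hz, hw] at h1
  have : ‖z - w‖ = 0 := by nlinarith
  exact sub_eq_zero.1 (norm_eq_zero.1 this)

theorem Complex.conj_mul_eq_of_norm_eq {x₀ x y₀ y : ℂ} (h₀ : ‖y₀‖ = ‖x₀‖) (h : ‖y‖ = ‖x‖)
    (hadd : ‖y₀ + y‖ = ‖x₀ + x‖) (hsub : ‖y₀ - I * y‖ = ‖x₀ - I * x‖) :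
    conj y₀ * y = conj x₀ * x := by
  have sq : ∀ {a b : ℂ}, ‖a‖ = ‖b‖ → a.re * a.re + a.im * a.im = b.re * b.re + b.im * b.im := by
    intro a b hab
    rw [← Complex.normSq_apply, ← Complex.normSq_apply, ← Complex.sq_norm, ← Complex.sq_norm, hab]
  have e₀ := sq h₀
  have e₁ := sq h
  have e₂ := sq hadd
  have e₃ := sq hsub
  simp only [add_re, add_im, sub_re, sub_im, mul_re, mul_im, I_re, I_im] at e₂ e₃
  apply Complex.ext <;> simp only [mul_re, mul_im, conj_re, conj_im] <;> linarith

/-- If `S` preserves transition amplitudes and those against the basis vectors, `b i₀ + b k` and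
`b i₀ + I • b k`, then `S` fixes every ray. -/
theorem exists_phase_smul_eq [Fintype ι] (b : OrthonormalBasis ι ℂ K) (i₀ : ι) {S : K → K}
    (hS : ∀ x y, ‖⟪S x, S y⟫_ℂ‖ = ‖⟪x, y⟫_ℂ‖)
    (hb : ∀ i x, ‖⟪b i, S x⟫_ℂ‖ = ‖⟪b i, x⟫_ℂ‖)
    (hadd : ∀ k ≠ i₀, ∀ x, ‖⟪b i₀ + b k, S x⟫_ℂ‖ = ‖⟪b i₀ + b k, x⟫_ℂ‖)
    (hI : ∀ k ≠ i₀, ∀ x, ‖⟪b i₀ + Complex.I • b k, S x⟫_ℂ‖ = ‖⟪b i₀ + Complex.I • b k, x⟫_ℂ‖)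
    (x : K) : ∃ c : ℂ, ‖c‖ = 1 ∧ S x = c • x := by
  have hnorm : ∀ x, ‖S x‖ = ‖x‖ := fun x => by
    have := hS x x
    rw [inner_self_eq_norm_sq_to_K, inner_self_eq_norm_sq_to_K] at this
    simpa using this
  have main : ∀ x, ⟪b i₀, x⟫_ℂ ≠ 0 → ∃ c : ℂ, ‖c‖ = 1 ∧ S x = c • x := by
    intro x hx
    have hy : ⟪b i₀, S x⟫_ℂ ≠ 0 := by rw [← norm_ne_zero_iff, hb]; exact norm_ne_zero_iff.2 hx
    have hc : ‖⟪b i₀, S x⟫_ℂ / ⟪b i₀, x⟫_ℂ‖ = 1 := by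
      rw [norm_div, hb, div_self (norm_ne_zero_iff.2 hx)]
    refine ⟨⟪b i₀, S x⟫_ℂ / ⟪b i₀, x⟫_ℂ, hc, b.repr.injective (PiLp.ext fun k => ?_)⟩
    rw [b.repr_apply_apply, b.repr_apply_apply, inner_smul_right]
    rcases eq_or_ne k i₀ with rfl | hk
    · rw [div_mul_cancel₀ _ hx]
    · have h1 := hadd k hk x
      have h2 := hI k hk x
      rw [inner_add_left, inner_add_left] at h1 h2
      rw [inner_smul_left, inner_smul_left, Complex.conj_I, neg_mul, neg_mul, ← sub_eq_add_neg,
        ← sub_eq_add_neg] at h2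
      have h3 := Complex.conj_mul_eq_of_norm_eq (hb i₀ x) (hb k x) h1 h2
      have h4 : conj ⟪b i₀, S x⟫_ℂ * ⟪b i₀, S x⟫_ℂ = conj ⟪b i₀, x⟫_ℂ * ⟪b i₀, x⟫_ℂ := by
        rw [Complex.conj_mul', Complex.conj_mul', hb]
      have h5 : conj ⟪b i₀, S x⟫_ℂ ≠ 0 := (map_ne_zero _).2 hy
      apply mul_left_cancel₀ h5
      rw [h3]
      field_simp
      linear_combination (-⟪b k, x⟫_ℂ) * h4
  by_cases hx : ⟪b i₀, x⟫_ℂ = 0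
  · rcases eq_or_ne x 0 with rfl | hx0
    · refine ⟨1, norm_one, ?_⟩
      rw [smul_zero, ← norm_eq_zero, hnorm, norm_zero]
    obtain ⟨c, hc, hSc⟩ := main (x + b i₀) (by simp [hx])
    have h1 := hS (x + b i₀) x
    have hx' : ⟪b i₀, S x⟫_ℂ = 0 := by rw [← norm_eq_zero, hb, hx, norm_zero]
    rw [hSc, inner_smul_left, norm_mul, RCLike.norm_conj, hc, one_mul, inner_add_left,
      inner_add_left, hx, hx', add_zero, add_zero] at h1
    have h2 : ‖⟪x, S x⟫_ℂ‖ = ‖x‖ * ‖S x‖ := by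
      rw [h1, hnorm, inner_self_eq_norm_sq_to_K]
      simp [sq]
    have hSx0 : S x ≠ 0 := by rw [← norm_ne_zero_iff, hnorm]; exact norm_ne_zero_iff.2 hx0
    obtain ⟨r, hr, hrx⟩ := (norm_inner_eq_norm_iff hx0 hSx0).1 h2
    refine ⟨r, ?_, hrx⟩
    have := hnorm x
    rw [hrx, norm_smul] at this
    exact (mul_eq_right₀ (norm_ne_zero_iff.2 hx0)).1 this
  · exact main x hx

theorem Orthonormal.exists_orthonormalBasis_coe_eq [FiniteDimensional ℂ K] [Fintype ι] {v : ι → K}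
    (hv : Orthonormal ℂ v) (hcard : Fintype.card ι = Module.finrank ℂ K) :
    ∃ g : OrthonormalBasis ι ℂ K, ⇑g = v := by
  obtain ⟨g, hg⟩ := Orthonormal.exists_orthonormalBasis_extension_of_card_eq (s := Set.univ)
    hcard.symm (hv.comp _ Subtype.val_injective)
  exact ⟨g, funext fun i => hg i (Set.mem_univ i)⟩

theorem OrthonormalBasis.exists_conjugation [Fintype ι] (b : OrthonormalBasis ι ℂ K) :
    ∃ J : K → K, (∀ x y, J (x + y) = J x + J y) ∧ (∀ (c : ℂ) x, J (c • x) = conj c • J x) ∧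
      (∀ x y, ⟪J x, J y⟫_ℂ = conj ⟪x, y⟫_ℂ) ∧ (∀ x, J (J x) = x) ∧ ∀ i, J (b i) = b i := by
  classical
  let J : K → K := fun x => b.repr.symm (WithLp.toLp 2 fun k => conj (b.repr x k))
  have hJ : ∀ x k, b.repr (J x) k = conj (b.repr x k) := fun x k => by simp [J]
  refine ⟨J, fun x y => ?_, fun c x => ?_, fun x y => ?_, fun x => ?_, fun i => ?_⟩
  · exact b.repr.injective (PiLp.ext fun k => by simp [hJ])
  · exact b.repr.injective (PiLp.ext fun k => by simp [hJ])
  · rw [← b.repr.inner_map_map, ← b.repr.inner_map_map, PiLp.inner_apply, PiLp.inner_apply, map_sum]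
    refine Finset.sum_congr rfl fun k _ => ?_
    simp [hJ]
  · exact b.repr.injective (PiLp.ext fun k => by simp [hJ])
  · refine b.repr.injective (PiLp.ext fun k => ?_)
    rw [hJ]
    simp [apply_ite]

/-- **Wigner's theorem** for finite-dimensional complex Hilbert spaces. -/
theorem wigner_of_norm_inner_eq [FiniteDimensional ℂ K] {T : K → K}
    (hT : ∀ x y, ‖⟪T x, T y⟫_ℂ‖ = ‖⟪x, y⟫_ℂ‖) :
    ∃ U : K → K, (∀ x y, U (x + y) = U x + U y) ∧ (∀ x, ‖U x‖ = ‖x‖) ∧ Function.Surjective U ∧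
      ((∀ (c : ℂ) (x : K), U (c • x) = c • U x) ∨
        (∀ (c : ℂ) (x : K), U (c • x) = conj c • U x)) ∧
      ∀ x, ∃ c : ℂ, ‖c‖ = 1 ∧ T x = c • U x := by
  classical
  have hnorm : ∀ x, ‖T x‖ = ‖x‖ := fun x => by
    have := hT x x
    rw [inner_self_eq_norm_sq_to_K, inner_self_eq_norm_sq_to_K] at this
    simpa using this
  rcases subsingleton_or_nontrivial K with hK | hK
  · exact ⟨id, fun _ _ => rfl, fun _ => rfl, Function.surjective_id, .inl fun _ _ => rfl,
      fun x => ⟨1, norm_one, Subsingleton.elim _ _⟩⟩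
  let b := stdOrthonormalBasis ℂ K
  have : NeZero (Module.finrank ℂ K) := ⟨Module.finrank_pos.ne'⟩
  let i₀ : Fin (Module.finrank ℂ K) := 0
  obtain ⟨f, hf⟩ := Orthonormal.exists_orthonormalBasis_coe_eq (v := fun i => T (b i)) (K := K)
    ⟨fun i => by rw [hnorm, b.norm_eq_one], fun i j hij => by
      simp only
      rw [← norm_eq_zero, hT, b.orthonormal.2 hij, norm_zero]⟩ (by simp)
  have hfT : ∀ i x, ‖⟪f i, T x⟫_ℂ‖ = ‖⟪b i, x⟫_ℂ‖ := fun i x => by rw [hf, hT]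
  have hbu : ∀ i, ⟪b i, ∑ j, b j⟫_ℂ = 1 := fun i => by
    simp [orthonormal_iff_ite.1 b.orthonormal]
  let θ : Fin (Module.finrank ℂ K) → ℂ := fun i => ⟪f i, T (∑ j, b j)⟫_ℂ
  have hθ : ∀ i, ‖θ i‖ = 1 := fun i => by simp only [θ]; rw [hfT, hbu, norm_one]
  obtain ⟨g, hg⟩ := Orthonormal.exists_orthonormalBasis_coe_eq (v := fun i => θ i • f i) (K := K)
    ⟨fun i => by rw [norm_smul, hθ, f.norm_eq_one, one_mul], fun i j hij => by
      simp only
      rw [inner_smul_left, inner_smul_right, f.orthonormal.2 hij, mul_zero, mul_zero]⟩ (by simp)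
  have hgT : ∀ i x, ‖⟪g i, T x⟫_ℂ‖ = ‖⟪b i, x⟫_ℂ‖ := fun i x => by
    rw [hg]
    simp only
    rw [inner_smul_left, norm_mul, RCLike.norm_conj, hθ, one_mul, hfT]
  have hgu : ∀ i, ⟪g i, T (∑ j, b j)⟫_ℂ = 1 := fun i => by
    rw [hg]
    simp only
    rw [inner_smul_left, Complex.conj_mul', hθ]
    norm_num
  have pair : ∀ i j, i ≠ j → ∀ a : ℂ, ‖a‖ = 1 → ∃ β : ℂ, ‖β‖ = 1 ∧
      ∀ y, ‖⟪g i + β • g j, T y⟫_ℂ‖ = ‖⟪b i + a • b j, y⟫_ℂ‖ := by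
    intro i j hij a ha
    let p := T (b i + a • b j)
    have hbp : ∀ k, ⟪b k, b i + a • b j⟫_ℂ = (if k = i then 1 else 0) + a * if k = j then 1 else 0 :=
      fun k => by
        rw [inner_add_right, inner_smul_right, orthonormal_iff_ite.1 b.orthonormal,
          orthonormal_iff_ite.1 b.orthonormal]
    have hi : ‖⟪g i, p⟫_ℂ‖ = 1 := by simp [p, hgT, hbp, hij]
    have hj : ‖⟪g j, p⟫_ℂ‖ = 1 := by simp [p, hgT, hbp, hij.symm, ha]
    have hi0 : ⟪g i, p⟫_ℂ ≠ 0 := by rw [← norm_ne_zero_iff, hi]; exact one_ne_zero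
    have hp : p = ⟪g i, p⟫_ℂ • (g i + (⟪g j, p⟫_ℂ / ⟪g i, p⟫_ℂ) • g j) := by
      rw [smul_add, smul_smul, mul_div_cancel₀ _ hi0]
      conv_lhs => rw [← g.sum_repr' p]
      rw [Finset.sum_eq_add_of_mem i j (Finset.mem_univ _) (Finset.mem_univ _) hij]
      rintro k - ⟨hki, hkj⟩
      have : ⟪g k, p⟫_ℂ = 0 := by
        rw [← norm_eq_zero]
        simp [p, hgT, hbp, hki, hkj]
      rw [this, zero_smul]
    refine ⟨⟪g j, p⟫_ℂ / ⟪g i, p⟫_ℂ, by rw [norm_div, hi, hj, div_one], fun y => ?_⟩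
    have h1 := hT (b i + a • b j) y
    rw [← h1, show T (b i + a • b j) = p from rfl]
    conv_rhs => rw [hp]
    rw [inner_smul_left, norm_mul, RCLike.norm_conj, hi, one_mul]
  have hadd : ∀ i j, i ≠ j → ∀ y, ‖⟪g i + g j, T y⟫_ℂ‖ = ‖⟪b i + b j, y⟫_ℂ‖ := by
    intro i j hij y
    obtain ⟨β, hβ, h⟩ := pair i j hij 1 norm_one
    have hu := h (∑ j, b j)
    rw [inner_add_left, inner_add_left, inner_smul_left, inner_smul_left, hgu, hgu, hbu, hbu,
      map_one, mul_one, mul_one] at hu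
    have h2 : (1 : ℂ) = conj β := Complex.eq_of_norm_add_eq_two norm_one
      (by rwa [RCLike.norm_conj]) (by rw [hu]; norm_num)
    have h3 : β = 1 := by rw [← Complex.conj_conj β, ← h2, map_one]
    simpa [h3] using h y
  let z := b i₀ + Complex.I • ∑ j ∈ Finset.univ.erase i₀, b j
  have hz₀ : ⟪b i₀, z⟫_ℂ = 1 := by
    simp only [z]
    rw [inner_add_right, inner_smul_right, inner_sum, Finset.sum_eq_zero fun j hj =>
      b.orthonormal.2 (Finset.ne_of_mem_erase hj).symm, mul_zero, add_zero,
      inner_self_eq_norm_sq_to_K, b.norm_eq_one]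
    simp
  have hz : ∀ k ≠ i₀, ⟪b k, z⟫_ℂ = Complex.I := by
    intro k hk
    simp only [z]
    rw [inner_add_right, inner_smul_right, inner_sum, b.orthonormal.2 hk, zero_add]
    simp [orthonormal_iff_ite.1 b.orthonormal, hk]
  let w : Fin (Module.finrank ℂ K) → ℂ := fun k => ⟪g k, T z⟫_ℂ
  have hw₀ : ‖w i₀‖ = 1 := by simp only [w]; rw [hgT, hz₀, norm_one]
  have hw : ∀ k ≠ i₀, ‖w k‖ = 1 := fun k hk => by simp only [w]; rw [hgT, hz k hk, Complex.norm_I]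
  have hweq : ∀ j ≠ i₀, ∀ k ≠ i₀, w j = w k := by
    intro j hj k hk
    rcases eq_or_ne j k with rfl | hjk
    · rfl
    refine Complex.eq_of_norm_add_eq_two (hw j hj) (hw k hk) ?_
    have := hadd j k hjk z
    rw [inner_add_left, inner_add_left, hz j hj, hz k hk] at this
    rw [this, ← two_mul]
    simp
  have hw₀0 : w i₀ ≠ 0 := by rw [← norm_ne_zero_iff, hw₀]; exact one_ne_zero
  have hs : ∀ k ≠ i₀, w k / w i₀ = Complex.I ∨ w k / w i₀ = -Complex.I := by
    intro k hk
    have h1 : ‖w k / w i₀‖ = 1 := by rw [norm_div, hw k hk, hw₀, div_one]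
    have h2 : ‖1 + w k / w i₀‖ = ‖1 + Complex.I‖ := by
      have := hadd i₀ k hk.symm z
      rw [inner_add_left, inner_add_left, hz k hk, hz₀] at this
      rw [← this, show ⟪g i₀, T z⟫_ℂ + ⟪g k, T z⟫_ℂ = w i₀ * (1 + w k / w i₀) by
        rw [mul_add, mul_div_cancel₀ _ hw₀0, mul_one], norm_mul, hw₀, one_mul]
    generalize w k / w i₀ = s at h1 h2
    have e1 : s.re * s.re + s.im * s.im = 1 := by
      rw [← Complex.normSq_apply, ← Complex.sq_norm, h1, one_pow]
    have e2 : (1 + s.re) * (1 + s.re) + s.im * s.im = 2 := by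
      have := congrArg (· ^ 2) h2
      simp only [Complex.sq_norm, Complex.normSq_apply] at this
      simp at this
      linarith
    have hre : s.re = 0 := by linarith
    have him : (s.im - 1) * (s.im + 1) = 0 := by rw [hre] at e1; linarith
    rcases mul_eq_zero.1 him with h | h
    · exact .inl (Complex.ext (by simpa using hre) (by simpa using by linarith))
    · exact .inr (Complex.ext (by simpa using hre) (by simp; linarith))
  have hI : ∀ k ≠ i₀, ∀ y, ‖⟪g i₀ + (w k / w i₀) • g k, T y⟫_ℂ‖ =
      ‖⟪b i₀ + Complex.I • b k, y⟫_ℂ‖ := by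
    intro k hk y
    obtain ⟨β, hβ, h⟩ := pair i₀ k hk.symm Complex.I Complex.norm_I
    have h1 := h z
    rw [inner_add_left, inner_add_left, inner_smul_left, inner_smul_left, hz k hk, hz₀,
      Complex.conj_mul', Complex.norm_I] at h1
    have h2 : w i₀ = conj β * w k := Complex.eq_of_norm_add_eq_two hw₀
      (by rw [norm_mul, RCLike.norm_conj, hβ, hw k hk, one_mul]) (by simp only [w]; rw [h1]; norm_num)
    have h3 : w k / w i₀ = β := by
      rw [div_eq_iff hw₀0, h2, ← mul_assoc, Complex.mul_conj', hβ]
      norm_num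
    rw [h3]
    exact h y
  have hsign : (∀ k ≠ i₀, w k / w i₀ = Complex.I) ∨ (∀ k ≠ i₀, w k / w i₀ = -Complex.I) := by
    by_contra! h
    obtain ⟨⟨j, hj, hj'⟩, k, hk, hk'⟩ := h
    rw [hweq k hk j hj] at hk'
    exact (hs j hj).elim hj' hk'
  let e : K ≃ₗᵢ[ℂ] K := b.equiv g (Equiv.refl _)
  have heb : ∀ i, e (b i) = g i := fun i => b.equiv_apply_basis g _ i
  have hsymm : ∀ x y, ⟪x, e.symm y⟫_ℂ = ⟪e x, y⟫_ℂ := fun x y => by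
    rw [← e.inner_map_map, e.apply_symm_apply]
  rcases hsign with hsign | hsign
  · refine ⟨e, e.map_add, e.norm_map, e.surjective, .inl fun c x => e.map_smul c x, fun x => ?_⟩
    obtain ⟨c, hc, h⟩ := exists_phase_smul_eq b i₀ (S := fun x => e.symm (T x))
      (fun x y => by rw [e.symm.inner_map_map, hT]) (fun i x => by rw [hsymm, heb, hgT])
      (fun k hk x => by rw [hsymm, map_add, heb, heb, hadd _ _ hk.symm])
      (fun k hk x => by
        rw [hsymm, map_add, map_smul, heb, heb, ← hI k hk, hsign k hk]) x
    exact ⟨c, hc, by rw [← map_smul, ← h, e.apply_symm_apply]⟩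
  · obtain ⟨J, hJadd, hJsmul, hJinner, hJJ, hJb⟩ := b.exists_conjugation
    have hJnorm : ∀ x y, ‖⟪x, J y⟫_ℂ‖ = ‖⟪J x, y⟫_ℂ‖ := fun x y => by
      rw [← hJJ x, hJinner, RCLike.norm_conj, hJJ]
    have hJn : ∀ x, ‖J x‖ = ‖x‖ := fun x => by
      have := congrArg norm (hJinner x x)
      rw [RCLike.norm_conj, inner_self_eq_norm_sq_to_K, inner_self_eq_norm_sq_to_K] at this
      simpa using this
    refine ⟨fun x => e (J x), fun x y => by simp only [hJadd, map_add], fun x => by rw [e.norm_map, hJn],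
      fun y => ⟨J (e.symm y), by simp only; rw [hJJ, e.apply_symm_apply]⟩,
      .inr fun c x => by simp only [hJsmul, map_smul], fun x => ?_⟩
    obtain ⟨c, hc, h⟩ := exists_phase_smul_eq b i₀ (S := fun x => J (e.symm (T x)))
      (fun x y => by rw [hJinner, RCLike.norm_conj, e.symm.inner_map_map, hT])
      (fun i x => by rw [hJnorm, hJb, hsymm, heb, hgT])
      (fun k hk x => by rw [hJnorm, hJadd, hJb, hJb, hsymm, map_add, heb, heb, hadd _ _ hk.symm])
      (fun k hk x => by
        rw [hJnorm, hJadd, hJsmul, hJb, hJb, hsymm, map_add, map_smul, heb, heb, Complex.conj_I,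
          ← hsign k hk, hI k hk]) x
    refine ⟨conj c, by rwa [RCLike.norm_conj], ?_⟩
    rw [← map_smul, ← hJsmul, ← h, hJJ, e.apply_symm_apply]

end Wigner

section RankOne

omit [CompleteSpace H] in
theorem rankOneProj_apply (v x : H) : rankOneProj v x = ⟪v, x⟫_ℂ • v := rfl

omit [CompleteSpace H] in
theorem continuous_rankOneProj : Continuous (rankOneProj : H → H →L[ℂ] H) := by
  unfold rankOneProj
  fun_prop

theorem isSelfAdjoint_rankOneProj (v : H) : IsSelfAdjoint (rankOneProj v) := by
  rw [ContinuousLinearMap.isSelfAdjoint_iff_isSymmetric]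
  intro x y
  simp only [ContinuousLinearMap.coe_coe, rankOneProj_apply, inner_smul_left, inner_smul_right,
    inner_conj_symm]
  ring

/-- The orthogonal projection onto the line spanned by a nonzero vector `x`. -/
noncomputable def lineProjection (x : H) : H →L[ℂ] H :=
  ((‖x‖ : ℂ) ^ 2)⁻¹ • rankOneProj x

omit [CompleteSpace H] in
theorem lineProjection_apply (x y : H) :
    lineProjection x y = (((‖x‖ : ℂ) ^ 2)⁻¹ * ⟪x, y⟫_ℂ) • x := by
  rw [lineProjection, smul_apply, rankOneProj_apply, smul_smul]

omit [CompleteSpace H] in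
theorem lineProjection_eq_rankOneProj {v : H} (hv : ‖v‖ = 1) :
    lineProjection v = rankOneProj v := by
  simp [lineProjection, hv]

omit [CompleteSpace H] in
theorem lineProjection_smul {c : ℂ} (hc : c ≠ 0) (x : H) :
    lineProjection (c • x) = lineProjection x := by
  ext y
  rw [lineProjection_apply, lineProjection_apply, smul_smul]
  congr 1
  have : (‖c‖ : ℂ) ≠ 0 := by simpa using hc
  rw [norm_smul, inner_smul_left, Complex.ofReal_mul, mul_pow, mul_inv, ← Complex.conj_mul',
    mul_inv]
  have hc' : conj c ≠ 0 := (map_ne_zero _).2 hc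
  field_simp

theorem isRankOneProjection_lineProjection {x : H} (hx : x ≠ 0) :
    IsRankOneProjection (lineProjection x) := by
  have hx' : (‖x‖ : ℂ) ≠ 0 := by simpa using hx
  have hself : lineProjection x x = x := by
    rw [lineProjection_apply, inner_self_eq_norm_sq_to_K]
    exact (congrArg (· • x) (inv_mul_cancel₀ (pow_ne_zero 2 hx'))).trans (one_smul _ _)
  refine ⟨?_, ?_, ?_⟩
  · refine IsSelfAdjoint.smul ?_ (isSelfAdjoint_rankOneProj x)
    rw [isSelfAdjoint_iff]
    simp
  · ext y
    rw [ContinuousLinearMap.comp_apply, lineProjection_apply x y, map_smul, hself]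
  · rw [finrank_eq_one_iff']
    refine ⟨⟨x, x, hself⟩, fun h => hx (congrArg Subtype.val h), ?_⟩
    rintro ⟨-, y, rfl⟩
    exact ⟨_, Subtype.ext (lineProjection_apply x y).symm⟩

theorem IsRankOneProjection.exists_rankOneProj {P : H →L[ℂ] H} (hP : IsRankOneProjection P) :
    ∃ v : H, ‖v‖ = 1 ∧ P = rankOneProj v := by
  obtain ⟨hsa, hidem, hrank⟩ := hP
  obtain ⟨⟨u, hu⟩, hu0, hspan⟩ := finrank_eq_one_iff'.1 hrank
  have hu0 : u ≠ 0 := fun h => hu0 (Subtype.ext h)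
  have hPP : ∀ x, P (P x) = P x := fun x => congrArg (· x) hidem
  have hPu : P u = u := by
    obtain ⟨x, rfl⟩ := hu
    exact hPP x
  refine ⟨(‖u‖ : ℂ)⁻¹ • u, by simpa using norm_smul_inv_norm (𝕜 := ℂ) hu0, ?_⟩
  have hk : (‖u‖ : ℂ)⁻¹ ≠ 0 := by simpa using hu0
  rw [← lineProjection_eq_rankOneProj (by simpa using norm_smul_inv_norm (𝕜 := ℂ) hu0),
    lineProjection_smul hk]
  ext x
  obtain ⟨c, hc⟩ := hspan ⟨P x, x, rfl⟩
  have hc : c • u = P x := congrArg Subtype.val hc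
  have h1 : ⟪u, P x⟫_ℂ = ⟪u, x⟫_ℂ := by
    conv_rhs => rw [← hPu]
    exact ((ContinuousLinearMap.isSelfAdjoint_iff_isSymmetric.1 hsa) u x).symm
  rw [← hc, inner_smul_right, inner_self_eq_norm_sq_to_K] at h1
  rw [lineProjection_apply, ← h1, ← hc]
  congr 1
  have : (‖u‖ : ℂ) ≠ 0 := by simpa using hu0
  simp only [Complex.coe_algebraMap]
  field_simp

theorem norm_rankOneProj_sub_sq {v w : H} (hv : ‖v‖ = 1) (hw : ‖w‖ = 1) :
    ‖rankOneProj v - rankOneProj w‖ ^ 2 = 1 - ‖⟪v, w⟫_ℂ‖ ^ 2 := by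
  set T := rankOneProj v - rankOneProj w with hTdef
  have hT : IsSelfAdjoint T := (isSelfAdjoint_rankOneProj v).sub (isSelfAdjoint_rankOneProj w)
  have hT2 : IsSelfAdjoint (T * T) := by
    rw [← sq]
    exact hT.pow 2
  have happ : ∀ x, T x = ⟪v, x⟫_ℂ • v - ⟪w, x⟫_ℂ • w := fun x => rfl
  have hvv : ⟪v, v⟫_ℂ = 1 := by simp [inner_self_eq_norm_sq_to_K, hv]
  have hww : ⟪w, w⟫_ℂ = 1 := by simp [inner_self_eq_norm_sq_to_K, hw]
  have hwv : ⟪w, v⟫_ℂ = conj ⟪v, w⟫_ℂ := (inner_conj_symm _ _).symm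
  have hs : ((1 - ‖⟪v, w⟫_ℂ‖ ^ 2 : ℝ) : ℂ) = 1 - ⟪v, w⟫_ℂ * ⟪w, v⟫_ℂ := by
    rw [hwv, Complex.mul_conj']
    simp
  have hs0 : 0 ≤ 1 - ‖⟪v, w⟫_ℂ‖ ^ 2 := by
    have := norm_inner_le_norm (𝕜 := ℂ) v w
    rw [hv, hw, one_mul] at this
    nlinarith [norm_nonneg ⟪v, w⟫_ℂ]
  have hTv : T (T v) = ((1 - ‖⟪v, w⟫_ℂ‖ ^ 2 : ℝ) : ℂ) • v := by
    simp only [hs, happ, inner_sub_right, inner_smul_right, hvv, hww]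
    module
  have hTw : T (T w) = ((1 - ‖⟪v, w⟫_ℂ‖ ^ 2 : ℝ) : ℂ) • w := by
    simp only [hs, happ, inner_sub_right, inner_smul_right, hvv, hww]
    module
  have h4 : (T * T) * (T * T) = ((1 - ‖⟪v, w⟫_ℂ‖ ^ 2 : ℝ) : ℂ) • (T * T) := by
    ext x
    change T (T (T (T x))) = ((1 - ‖⟪v, w⟫_ℂ‖ ^ 2 : ℝ) : ℂ) • T (T x)
    rw [happ x]
    simp only [map_sub, map_smul, hTv, hTw]
    module
  have hn := hT2.norm_mul_self
  rw [h4, norm_smul, Complex.norm_real, Real.norm_of_nonneg hs0, hT.norm_mul_self] at hn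
  rcases eq_or_ne T 0 with h0 | h0
  · have hv0 : v ≠ 0 := by
      rw [← norm_ne_zero_iff, hv]
      exact one_ne_zero
    rw [h0] at hTv
    have : ((1 - ‖⟪v, w⟫_ℂ‖ ^ 2 : ℝ) : ℂ) = 0 := (smul_eq_zero.1 hTv.symm).resolve_right hv0
    rw [Complex.ofReal_eq_zero] at this
    rw [h0, this]
    simp
  · have : ‖T‖ ^ 2 ≠ 0 := pow_ne_zero 2 (norm_ne_zero_iff.2 h0)
    apply mul_right_cancel₀ this
    linarith

theorem norm_inner_sq_eq_lineProjection {x y : H} (hx : x ≠ 0) (hy : y ≠ 0) :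
    ‖⟪x, y⟫_ℂ‖ ^ 2 =
      ‖x‖ ^ 2 * ‖y‖ ^ 2 * (1 - ‖lineProjection x - lineProjection y‖ ^ 2) := by
  have hx1 : ‖(‖x‖ : ℂ)⁻¹ • x‖ = 1 := by simpa using norm_smul_inv_norm (𝕜 := ℂ) hx
  have hy1 : ‖(‖y‖ : ℂ)⁻¹ • y‖ = 1 := by simpa using norm_smul_inv_norm (𝕜 := ℂ) hy
  have hx0 : ‖x‖ ≠ 0 := norm_ne_zero_iff.2 hx
  have hy0 : ‖y‖ ≠ 0 := norm_ne_zero_iff.2 hy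
  rw [← lineProjection_smul (c := (‖x‖ : ℂ)⁻¹) (by simpa using hx) x,
    ← lineProjection_smul (c := (‖y‖ : ℂ)⁻¹) (by simpa using hy) y,
    lineProjection_eq_rankOneProj hx1, lineProjection_eq_rankOneProj hy1,
    norm_rankOneProj_sub_sq hx1 hy1, inner_smul_left, inner_smul_right]
  simp only [norm_mul, RCLike.norm_conj, norm_inv, Complex.norm_real, norm_norm]
  field_simp
  ring

omit [CompleteSpace H] in
theorem add_ne_zero_of_mem_orthogonal {p : H} (hp : ‖p‖ = 1) (v : (ℂ ∙ p)ᗮ) : p + (v : H) ≠ 0 := by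
  intro h
  have h1 : ⟪p, p + (v : H)⟫_ℂ = 1 := by
    rw [inner_add_right, Submodule.mem_orthogonal_singleton_iff_inner_right.1 v.2,
      inner_self_eq_norm_sq_to_K, hp]
    simp
  rw [h, inner_zero_right] at h1
  exact zero_ne_one h1

omit [CompleteSpace H] in
theorem continuous_lineProjection_add {p : H} (hp : ‖p‖ = 1) :
    Continuous fun v : (ℂ ∙ p)ᗮ => lineProjection (p + (v : H)) := by
  unfold lineProjection
  have h : Continuous fun v : (ℂ ∙ p)ᗮ => p + (v : H) := by fun_prop
  refine Continuous.smul (Continuous.inv₀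
    (by exact (Complex.continuous_ofReal.comp h.norm).pow 2) fun v => ?_)
    (continuous_rankOneProj.comp h)
  simpa using add_ne_zero_of_mem_orthogonal hp v

/-- The affine chart of projective space around the line spanned by `p`, sending the projection
onto the line through `p + v`, with `v ⟂ p`, to `v`. -/
noncomputable def lineChart (p : H) (Q : H →L[ℂ] H) : (ℂ ∙ p)ᗮ :=
  (ℂ ∙ p)ᗮ.orthogonalProjectionOnto ((⟪p, Q p⟫_ℂ)⁻¹ • Q p)

omit [CompleteSpace H] in
theorem continuousOn_lineChart (p : H) :
    ContinuousOn (lineChart p) {Q | ⟪p, Q p⟫_ℂ ≠ 0} := by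
  have h : Continuous fun Q : H →L[ℂ] H => Q p := by fun_prop
  exact ((ℂ ∙ p)ᗮ.orthogonalProjectionOnto).continuous.comp_continuousOn
    ((ContinuousOn.inv₀ (continuous_const.inner h).continuousOn fun Q hQ => hQ).smul
      h.continuousOn)

omit [CompleteSpace H] in
theorem lineChart_lineProjection {p u : H} (hp : ‖p‖ = 1) (hu : u ≠ 0) (hpu : ⟪p, u⟫_ℂ ≠ 0) :
    (lineChart p (lineProjection u) : H) = (⟪p, u⟫_ℂ)⁻¹ • u - p := by
  have hup : ⟪u, p⟫_ℂ ≠ 0 := by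
    rw [← inner_conj_symm]
    exact (map_ne_zero _).2 hpu
  have hu' : (‖u‖ : ℂ) ≠ 0 := by simpa using hu
  have h1 : (⟪p, lineProjection u p⟫_ℂ)⁻¹ • lineProjection u p = (⟪p, u⟫_ℂ)⁻¹ • u := by
    rw [lineProjection_apply, inner_smul_right, smul_smul]
    congr 1
    field_simp
  rw [lineChart, h1, ← Submodule.starProjection_apply, Submodule.starProjection_orthogonal_val,
    Submodule.starProjection_unit_singleton ℂ hp, inner_smul_right, inv_mul_cancel₀ hpu, one_smul]

omit [CompleteSpace H] in
theorem lineChart_lineProjection_add {p : H} (hp : ‖p‖ = 1) (v : (ℂ ∙ p)ᗮ) :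
    lineChart p (lineProjection (p + (v : H))) = v := by
  have h1 : ⟪p, p + (v : H)⟫_ℂ = 1 := by
    rw [inner_add_right, Submodule.mem_orthogonal_singleton_iff_inner_right.1 v.2,
      inner_self_eq_norm_sq_to_K, hp]
    simp
  apply Subtype.ext
  rw [lineChart_lineProjection hp (add_ne_zero_of_mem_orthogonal hp v) (by simp [h1]), h1]
  simp

theorem lineProjection_add_lineChart {p : H} (hp : ‖p‖ = 1) {Q : H →L[ℂ] H}
    (hQ : IsRankOneProjection Q) (hpQ : ⟪p, Q p⟫_ℂ ≠ 0) :
    lineProjection (p + (lineChart p Q : H)) = Q := by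
  obtain ⟨u, hu, rfl⟩ := hQ.exists_rankOneProj
  have hu0 : u ≠ 0 := by
    rw [← norm_ne_zero_iff, hu]
    exact one_ne_zero
  have hpu : ⟪p, u⟫_ℂ ≠ 0 := by
    intro h
    rw [rankOneProj_apply, inner_smul_right, h, mul_zero] at hpQ
    exact hpQ rfl
  rw [← lineProjection_eq_rankOneProj hu, lineChart_lineProjection hp hu0 hpu, add_sub_cancel,
    lineProjection_smul (inv_ne_zero hpu)]

omit [CompleteSpace H] in
theorem finrank_orthogonal_eq_of_norm_eq_one [FiniteDimensional ℂ H] {p q : H} (hp : ‖p‖ = 1)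
    (hq : ‖q‖ = 1) : Module.finrank ℝ (ℂ ∙ p)ᗮ = Module.finrank ℝ (ℂ ∙ q)ᗮ := by
  have hp0 : p ≠ 0 := by
    rw [← norm_ne_zero_iff, hp]
    exact one_ne_zero
  have hq0 : q ≠ 0 := by
    rw [← norm_ne_zero_iff, hq]
    exact one_ne_zero
  have h1 := Submodule.finrank_add_finrank_orthogonal (ℂ ∙ p)
  have h2 := Submodule.finrank_add_finrank_orthogonal (ℂ ∙ q)
  rw [finrank_span_singleton hp0] at h1
  rw [finrank_span_singleton hq0] at h2
  rw [finrank_real_of_complex, finrank_real_of_complex]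
  omega

theorem exists_continuous_surjective_sphere [FiniteDimensional ℂ H] :
    ∃ f : Metric.sphere (0 : H) 1 → {P : H →L[ℂ] H // IsRankOneProjection P},
      Continuous f ∧ Function.Surjective f := by
  have h (v : Metric.sphere (0 : H) 1) : IsRankOneProjection (rankOneProj (v : H)) := by
    have hv : ‖(v : H)‖ = 1 := by simp
    rw [← lineProjection_eq_rankOneProj hv]
    exact isRankOneProjection_lineProjection (norm_ne_zero_iff.1 (by simp [hv]))
  refine ⟨fun v => ⟨_, h v⟩, (continuous_rankOneProj.comp continuous_subtype_val).subtype_mk _, ?_⟩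
  rintro ⟨P, hP⟩
  obtain ⟨v, hv, rfl⟩ := hP.exists_rankOneProj
  exact ⟨⟨v, by simpa using hv⟩, rfl⟩

theorem surjective_of_continuous_injective_rankOneProjection [FiniteDimensional ℂ H]
    (hdim : 2 ≤ Module.finrank ℂ H)
    {φ : {P : H →L[ℂ] H // IsRankOneProjection P} → {P : H →L[ℂ] H // IsRankOneProjection P}}
    (hφ : Continuous φ) (hinj : Function.Injective φ) : Function.Surjective φ := by
  obtain ⟨f, hf, hfs⟩ := exists_continuous_surjective_sphere (H := H)
  have : FiniteDimensional ℝ H := FiniteDimensional.complexToReal H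
  have : ProperSpace H := FiniteDimensional.proper_real H
  have hconn : IsConnected (Metric.sphere (0 : H) 1) := isConnected_sphere
    (by
      have : 1 < Module.finrank ℝ H := by
        rw [finrank_real_of_complex]
        omega
      exact_mod_cast Module.lt_rank_of_lt_finrank this) 0 zero_le_one
  have : ConnectedSpace (Metric.sphere (0 : H) 1) := isConnected_iff_connectedSpace.1 hconn
  have : CompactSpace (Metric.sphere (0 : H) 1) := isCompact_iff_compactSpace.1 (isCompact_sphere 0 1)
  have : CompactSpace {P : H →L[ℂ] H // IsRankOneProjection P} := hfs.compactSpace hf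
  have : PreconnectedSpace {P : H →L[ℂ] H // IsRankOneProjection P} :=
    hfs.denseRange.preconnectedSpace hf
  have : Nonempty {P : H →L[ℂ] H // IsRankOneProjection P} :=
    (inferInstance : Nonempty (Metric.sphere (0 : H) 1)).map f
  refine Set.range_eq_univ.1 (IsClopen.eq_univ ⟨(isCompact_range hφ).isClosed, ?_⟩
    (Set.range_nonempty φ))
  rw [isOpen_iff_mem_nhds]
  rintro _ ⟨P₀, rfl⟩
  obtain ⟨p, hp, hP₀⟩ := P₀.2.exists_rankOneProj
  obtain ⟨q, hq, hQ₀⟩ := (φ P₀).2.exists_rankOneProj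
  let c : (ℂ ∙ p)ᗮ → {P : H →L[ℂ] H // IsRankOneProjection P} := fun v =>
    ⟨lineProjection (p + (v : H)),
      isRankOneProjection_lineProjection (add_ne_zero_of_mem_orthogonal hp v)⟩
  have hc : Continuous c := (continuous_lineProjection_add hp).subtype_mk _
  have hcinj : Function.Injective c := fun v w h => by
    have h' : lineProjection (p + (v : H)) = lineProjection (p + (w : H)) := congrArg Subtype.val h
    exact (lineChart_lineProjection_add hp v).symm.trans
      ((congrArg (lineChart p) h').trans (lineChart_lineProjection_add hp w))
  have hc0 : c 0 = P₀ := Subtype.ext (by simp [c, hP₀, lineProjection_eq_rankOneProj hp])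
  let U : Set {P : H →L[ℂ] H // IsRankOneProjection P} := {Q | ⟪q, Q.1 q⟫_ℂ ≠ 0}
  have hU : IsOpen U := isOpen_ne_fun (by fun_prop) continuous_const
  have hUφ : φ P₀ ∈ U := by
    change ⟪q, (φ P₀).1 q⟫_ℂ ≠ 0
    rw [hQ₀, rankOneProj_apply, inner_self_eq_norm_sq_to_K, hq, inner_smul_right,
      inner_self_eq_norm_sq_to_K, hq]
    norm_num
  let d : {P : H →L[ℂ] H // IsRankOneProjection P} → (ℂ ∙ q)ᗮ := fun Q => lineChart q Q.1
  have hd : ContinuousOn d U :=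
    (continuousOn_lineChart q).comp continuous_subtype_val.continuousOn fun Q hQ => hQ
  have hdinj : Set.InjOn d U := fun P hP Q hQ h => Subtype.ext (by
    rw [← lineProjection_add_lineChart hq P.2 hP, ← lineProjection_add_lineChart hq Q.2 hQ]
    exact congrArg (fun v : (ℂ ∙ q)ᗮ => lineProjection (q + (v : H))) h)
  have hs : (φ ∘ c) ⁻¹' U ∈ nhds (0 : (ℂ ∙ p)ᗮ) :=
    (hU.preimage (hφ.comp hc)).mem_nhds (by simpa [hc0] using hUφ)
  have key := image_mem_nhds_of_injOn (finrank_orthogonal_eq_of_norm_eq_one hp hq) hs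
    (f := d ∘ φ ∘ c) (hd.comp (hφ.comp hc).continuousOn fun v hv => hv)
    (hdinj.comp (hinj.comp hcinj).injOn fun v hv => hv)
  simp only [Function.comp_apply, hc0] at key
  filter_upwards [hU.mem_nhds hUφ, (hd.continuousAt (hU.mem_nhds hUφ)).preimage_mem_nhds key]
  rintro Q hQ ⟨v, hv, hvQ⟩
  exact ⟨c v, hdinj hv hQ hvQ⟩

theorem norm_sub_eq_of_surjective_nonexpansive [FiniteDimensional ℂ H]
    {φ : {P : H →L[ℂ] H // IsRankOneProjection P} → {P : H →L[ℂ] H // IsRankOneProjection P}}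
    (hinj : Function.Injective φ) (hsurj : Function.Surjective φ)
    (hne : ∀ P Q : {P : H →L[ℂ] H // IsRankOneProjection P},
      ‖(φ P).1 - (φ Q).1‖ ≤ ‖P.1 - Q.1‖) (P Q : {P : H →L[ℂ] H // IsRankOneProjection P}) :
    ‖(φ P).1 - (φ Q).1‖ = ‖P.1 - Q.1‖ := by
  have hle : ∀ (P Q : {P : H →L[ℂ] H // IsRankOneProjection P}) (x y x' y' : H), ‖x‖ = 1 → ‖y‖ = 1 →
      ‖x'‖ = 1 → ‖y'‖ = 1 → P.1 = rankOneProj x → Q.1 = rankOneProj y →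
      (φ P).1 = rankOneProj x' → (φ Q).1 = rankOneProj y' → ‖⟪x, y⟫_ℂ‖ ^ 2 ≤ ‖⟪x', y'⟫_ℂ‖ ^ 2 := by
    intro P Q x y x' y' hx hy hx' hy' hP hQ hP' hQ'
    have h := pow_le_pow_left₀ (norm_nonneg _) (hne P Q) 2
    rw [hP, hQ, hP', hQ', norm_rankOneProj_sub_sq hx hy, norm_rankOneProj_sub_sq hx' hy'] at h
    linarith
  obtain ⟨y, hy, hQ⟩ := Q.2.exists_rankOneProj
  obtain ⟨x', hx', hP'⟩ := (φ P).2.exists_rankOneProj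
  obtain ⟨y', hy', hQ'⟩ := (φ Q).2.exists_rankOneProj
  have hx'0 : x' ≠ 0 := by
    rw [← norm_ne_zero_iff, hx']
    exact one_ne_zero
  have : Nontrivial H := ⟨x', 0, hx'0⟩
  have : NeZero (Module.finrank ℂ H) := ⟨Module.finrank_pos.ne'⟩
  obtain ⟨r, hr⟩ := Orthonormal.exists_orthonormalBasis_extension_of_card_eq (𝕜 := ℂ)
    (ι := Fin (Module.finrank ℂ H)) (by simp) (v := fun _ => x') (s := {0})
    ⟨fun _ => hx', fun i j hij => (hij (Subsingleton.elim i j)).elim⟩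
  have hr0 : r 0 = x' := hr 0 rfl
  have hr1 : ∀ i, IsRankOneProjection (rankOneProj (r i)) := fun i => by
    rw [← lineProjection_eq_rankOneProj (r.norm_eq_one i)]
    exact isRankOneProjection_lineProjection (r.orthonormal.ne_zero i)
  choose R hR using fun i => hsurj ⟨_, hr1 i⟩
  choose v hv hRv using fun i => (R i).2.exists_rankOneProj
  have hRP : R 0 = P := hinj (by
    rw [hR]
    exact Subtype.ext ((congrArg rankOneProj hr0).trans hP'.symm))
  have hRr : ∀ i, (φ (R i)).1 = rankOneProj (r i) := fun i => by rw [hR]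
  obtain ⟨g, hg⟩ := Orthonormal.exists_orthonormalBasis_coe_eq (v := v)
    ⟨hv, fun i j hij => by
      have := hle (R i) (R j) _ _ _ _ (hv i) (hv j) (r.norm_eq_one i) (r.norm_eq_one j) (hRv i) (hRv j)
        (hRr i) (hRr j)
      rw [r.orthonormal.2 hij, norm_zero, zero_pow two_ne_zero] at this
      exact norm_eq_zero.1 (pow_eq_zero_iff two_ne_zero |>.1 (le_antisymm this (sq_nonneg _)))⟩
    (by simp)
  have hterm : ∀ i ∈ Finset.univ, ‖⟪g i, y⟫_ℂ‖ ^ 2 ≤ ‖⟪r i, y'⟫_ℂ‖ ^ 2 := fun i _ => by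
    rw [hg]
    exact hle (R i) Q _ _ _ _ (hv i) hy (r.norm_eq_one i) hy' (hRv i) hQ (hRr i) hQ'
  have heq := (Finset.sum_eq_sum_iff_of_le hterm).1
    (by rw [g.sum_sq_norm_inner_right, r.sum_sq_norm_inner_right, hy, hy']) 0 (Finset.mem_univ _)
  rw [hg, hr0] at heq
  rw [← sq_eq_sq₀ (norm_nonneg _) (norm_nonneg _), hP', hQ', ← hRP, hRv, hQ,
    norm_rankOneProj_sub_sq hx' hy', norm_rankOneProj_sub_sq (hv 0) hy, heq]

end RankOne

/-- Corollary 1.2 (3). If `H` is finite-dimensional with `dim H ≥ 2`,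
then every injective nonexpansive map on the set of rank-one projections is a
Wigner symmetry. -/
theorem finiteDimensional_injective_nonexpansive_is_wigner
    [FiniteDimensional ℂ H] (hdim : 2 ≤ Module.finrank ℂ H)
    (φ : {P : H →L[ℂ] H // IsRankOneProjection P} → {P : H →L[ℂ] H // IsRankOneProjection P})
    (hinj : Function.Injective φ)
    (hne : ∀ P Q : {P : H →L[ℂ] H // IsRankOneProjection P},
      ‖(φ P).1 - (φ Q).1‖ ≤ ‖P.1 - Q.1‖) :
    IsWignerSymmetry φ := by
  have hlip : LipschitzWith 1 φ := LipschitzWith.of_dist_le_mul fun P Q => by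
    rw [Subtype.dist_eq, Subtype.dist_eq, dist_eq_norm, dist_eq_norm, NNReal.coe_one, one_mul]
    exact hne P Q
  have hiso := norm_sub_eq_of_surjective_nonexpansive hinj
    (surjective_of_continuous_injective_rankOneProjection hdim hlip.continuous hinj) hne
  have hex : ∀ x : H, ∃ y : H, ‖y‖ = ‖x‖ ∧ ∀ hx : x ≠ 0,
      (φ ⟨_, isRankOneProjection_lineProjection hx⟩).1 = lineProjection y := by
    intro x
    by_cases hx : x = 0
    · exact ⟨0, by rw [hx], fun h => (h hx).elim⟩
    · obtain ⟨v, hv, h⟩ := (φ ⟨_, isRankOneProjection_lineProjection hx⟩).2.exists_rankOneProj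
      refine ⟨(‖x‖ : ℂ) • v, by simp [norm_smul, hv], fun _ => ?_⟩
      rw [h, lineProjection_smul (by simpa using hx), lineProjection_eq_rankOneProj hv]
  choose T hTnorm hT using hex
  have hT0 : ∀ x, x ≠ 0 → T x ≠ 0 := fun x hx => by
    rw [← norm_ne_zero_iff, hTnorm]
    exact norm_ne_zero_iff.2 hx
  have hTinner : ∀ x y, ‖⟪T x, T y⟫_ℂ‖ = ‖⟪x, y⟫_ℂ‖ := by
    intro x y
    rcases eq_or_ne x 0 with rfl | hx
    · rw [norm_eq_zero.1 ((hTnorm 0).trans norm_zero), inner_zero_left, inner_zero_left]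
    rcases eq_or_ne y 0 with rfl | hy
    · rw [norm_eq_zero.1 ((hTnorm 0).trans norm_zero), inner_zero_right, inner_zero_right]
    rw [← sq_eq_sq₀ (norm_nonneg _) (norm_nonneg _),
      norm_inner_sq_eq_lineProjection (hT0 x hx) (hT0 y hy), norm_inner_sq_eq_lineProjection hx hy,
      hTnorm, hTnorm, ← hT x hx, ← hT y hy, hiso]
  obtain ⟨U, hadd, hnorm, hsurj, hlin, hU⟩ := wigner_of_norm_inner_eq hTinner
  refine ⟨U, hadd, hnorm, hsurj, hlin, fun v hv P hP => ?_⟩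
  have hv0 : v ≠ 0 := by
    rw [← norm_ne_zero_iff, hv]
    exact one_ne_zero
  obtain ⟨c, hc, hTU⟩ := hU v
  have hc0 : c ≠ 0 := by
    rw [← norm_ne_zero_iff, hc]
    exact one_ne_zero
  have hPv : P = ⟨_, isRankOneProjection_lineProjection hv0⟩ :=
    Subtype.ext (hP.trans (lineProjection_eq_rankOneProj hv).symm)
  rw [hPv, hT v hv0, hTU, lineProjection_smul hc0,
    lineProjection_eq_rankOneProj ((hnorm v).trans hv)]
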